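/- Let (Ω,F,P) be a non-atomic probability space, G ⊆ F a sub-σ-algebra, u1, u2 ∈ U⁺_icx and α ∈ (0,1). The conditional generalized quantile ρ_α^G is monotone: for all X, Y ∈ L∞(F) with X ≤ Y P-a.s., one has ρ_α^G(X) ≤ ρ_α^G(Y) P-a.s. -/

import Mathlib

open MeasureTheory Set Filter Topology

variable {Ω : Type*}

/-- `Z ∈ L∞(𝒢)`: `Z` is `𝒢`-measurable and bounded. -/
def BddMeas (𝒢 : MeasurableSpace Ω) (Z : Ω → ℝ) : Prop :=
  Measurable[𝒢] Z ∧ ∃ C : ℝ, ∀ ω, |Z ω| ≤ C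

/-- `u ∈ U⁺_icx`: `u` is strictly increasing and convex on `[0,∞)` with `u 0 = 0`, `u 1 = 1`. -/
def Uicx (u : ℝ → ℝ) : Prop :=
  StrictMonoOn u (Set.Ici 0) ∧ ConvexOn ℝ (Set.Ici 0) u ∧ u 0 = 0 ∧ u 1 = 1

/-- `π_α(X,Z) = α·E[u1((X−Z)⁺)] + (1−α)·E[u2((X−Z)⁻)]`. -/
noncomputable def piRisk {mΩ : MeasurableSpace Ω} (P : Measure Ω) (u1 u2 : ℝ → ℝ) (α : ℝ)
    (X Z : Ω → ℝ) : ℝ :=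
  α * ∫ ω, u1 (max (X ω - Z ω) 0) ∂P + (1 - α) * ∫ ω, u2 (max (Z ω - X ω) 0) ∂P

/-- The set of minimizers of `Z ↦ π_α(X,Z)` over `L∞(𝒢)`. -/
def ArgminSet {mΩ : MeasurableSpace Ω} (P : Measure Ω) (𝒢 : MeasurableSpace Ω)
    (u1 u2 : ℝ → ℝ) (α : ℝ) (X : Ω → ℝ) : Set (Ω → ℝ) :=
  {Z | BddMeas 𝒢 Z ∧ ∀ W, BddMeas 𝒢 W → piRisk P u1 u2 α X Z ≤ piRisk P u1 u2 α X W}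

/-- `ρ` is an essential infimum of the family `S` of random variables in the a.s. order. -/
def IsEssInf {mΩ : MeasurableSpace Ω} (P : Measure Ω) (S : Set (Ω → ℝ)) (ρ : Ω → ℝ) : Prop :=
  (∀ Z ∈ S, ρ ≤ᵐ[P] Z) ∧ ∀ W : Ω → ℝ, (∀ Z ∈ S, W ≤ᵐ[P] Z) → W ≤ᵐ[P] ρ

/-- The probability space is non-atomic. -/
def Nonatomic {mΩ : MeasurableSpace Ω} (P : Measure Ω) : Prop :=
  ∀ A : Set Ω, MeasurableSet[mΩ] A → 0 < P A →
    ∃ B ⊆ A, MeasurableSet[mΩ] B ∧ 0 < P B ∧ P B < P A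

/-- The acceptance set of the conditional shortfall risk measure:
`{Z ∈ L∞(𝒢) : E[v(X−Z)|𝒢] ≤ 0 a.s.}`. -/
def ShortfallSet {mΩ : MeasurableSpace Ω} (P : Measure Ω) (𝒢 : MeasurableSpace Ω)
    (v : ℝ → ℝ) (X : Ω → ℝ) : Set (Ω → ℝ) :=
  {Z | BddMeas 𝒢 Z ∧ ∀ᵐ ω ∂P, (P[fun ω' => v (X ω' - Z ω')|𝒢]) ω ≤ 0}

/-- Left derivative of `u` at `x`, multiplied by the indicator of `{x > 0}`. -/
noncomputable def ldInd (u : ℝ → ℝ) (x : ℝ) : ℝ :=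
  if 0 < x then derivWithin u (Set.Iic x) x else 0

/-- Right derivative of `u` at `x`, multiplied by the indicator of `{x ≥ 0}`. -/
noncomputable def rdInd (u : ℝ → ℝ) (x : ℝ) : ℝ :=
  if 0 ≤ x then derivWithin u (Set.Ici x) x else 0

/-- The function `v` built from `u1, u2, α`: `v(x) = α·(u1)'_−(x)` for `x > 0` and
`v(x) = −(1−α)·(u2)'_+(−x)` for `x ≤ 0`. -/
noncomputable def vFun (u1 u2 : ℝ → ℝ) (α : ℝ) (x : ℝ) : ℝ :=
  if 0 < x then α * derivWithin u1 (Set.Iic x) x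
  else -((1 - α) * derivWithin u2 (Set.Ici (-x)) (-x))

/-- `ρ` is a conditional convex risk measure: monotone, conditionally translation
invariant, conditionally convex and normalized. -/
def IsCondConvexRM {mΩ : MeasurableSpace Ω} (P : Measure Ω) (𝒢 : MeasurableSpace Ω)
    (ρ : (Ω → ℝ) → (Ω → ℝ)) : Prop :=
  (∀ X Y : Ω → ℝ, BddMeas mΩ X → BddMeas mΩ Y → X ≤ᵐ[P] Y → ρ X ≤ᵐ[P] ρ Y) ∧
  (∀ X Z : Ω → ℝ, BddMeas mΩ X → BddMeas 𝒢 Z →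
      ρ (fun ω => X ω + Z ω) =ᵐ[P] fun ω => ρ X ω + Z ω) ∧
  (∀ X Y Λ : Ω → ℝ, BddMeas mΩ X → BddMeas mΩ Y → BddMeas 𝒢 Λ →
      (∀ᵐ ω ∂P, 0 ≤ Λ ω ∧ Λ ω ≤ 1) →
      ρ (fun ω => Λ ω * X ω + (1 - Λ ω) * Y ω) ≤ᵐ[P]
        fun ω => Λ ω * ρ X ω + (1 - Λ ω) * ρ Y ω) ∧
  (ρ (fun _ => 0) =ᵐ[P] fun _ => 0)

/-- `ρ` is a conditional coherent risk measure: a conditional convex risk measure that is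
conditionally positively homogeneous. -/
def IsCondCoherentRM {mΩ : MeasurableSpace Ω} (P : Measure Ω) (𝒢 : MeasurableSpace Ω)
    (ρ : (Ω → ℝ) → (Ω → ℝ)) : Prop :=
  IsCondConvexRM P 𝒢 ρ ∧
  ∀ X Λ : Ω → ℝ, BddMeas mΩ X → BddMeas 𝒢 Λ → (∀ᵐ ω ∂P, 0 ≤ Λ ω) →
    ρ (fun ω => Λ ω * X ω) =ᵐ[P] fun ω => Λ ω * ρ X ω

/-- `𝒢` is generated by a finite measurable partition of `Ω`, each cell having positive
probability. -/
def FinitePartitionGen {mΩ : MeasurableSpace Ω} (P : Measure Ω)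
    (𝒢 : MeasurableSpace Ω) : Prop :=
  ∃ (n : ℕ) (A : Fin n → Set Ω),
    (∀ i, MeasurableSet[mΩ] (A i)) ∧ (∀ i, 0 < P (A i)) ∧
    Pairwise (Function.onFun Disjoint A) ∧ (⋃ i, A i) = Set.univ ∧
    𝒢 = MeasurableSpace.generateFrom {s | ∃ i, s = A i}

theorem aux_convex {u : ℝ → ℝ} (h : Uicx u) : ConvexOn ℝ Set.univ (fun t : ℝ => u (max t 0)) := by
  refine ⟨convex_univ, ?_⟩
  intro x _ y _ a b ha hb hab
  have hx : (0:ℝ) ≤ max x 0 := le_max_right _ _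
  have hy : (0:ℝ) ≤ max y 0 := le_max_right _ _
  refine le_trans ?_ (h.2.1.2 (Set.mem_Ici.2 hx) (Set.mem_Ici.2 hy) ha hb hab)
  simp only [smul_eq_mul]
  have h0 : 0 ≤ a * max x 0 + b * max y 0 := by positivity
  apply h.1.monotoneOn (Set.mem_Ici.2 (le_max_right _ _)) (Set.mem_Ici.2 h0)
  apply max_le _ h0
  have := mul_le_mul_of_nonneg_left (le_max_left x 0) ha
  have := mul_le_mul_of_nonneg_left (le_max_left y 0) hb
  linarith

theorem aux_four {g : ℝ → ℝ} (hg : ConvexOn ℝ Set.univ g) {a b c d : ℝ}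
    (hab : a ≤ b) (hac : a ≤ c) (hs : b + c = a + d) : g b + g c ≤ g a + g d := by
  rcases eq_or_lt_of_le (show a ≤ d by linarith) with had | had
  · have hb : b = a := by linarith
    have hc : c = d := by linarith
    rw [hb, hc]
  · have hp : 0 < d - a := by linarith
    have e1 : (c - a) / (d - a) + (b - a) / (d - a) = 1 := by
      field_simp; linarith
    have n1 : 0 ≤ (c - a) / (d - a) := div_nonneg (by linarith) hp.le
    have n2 : 0 ≤ (b - a) / (d - a) := div_nonneg (by linarith) hp.le
    have k1 := hg.2 (Set.mem_univ a) (Set.mem_univ d) n1 n2 e1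
    have k2 := hg.2 (Set.mem_univ a) (Set.mem_univ d) n2 n1 (by linarith)
    have hc : c = a + d - b := by linarith
    have p1 : (c - a) / (d - a) * a + (b - a) / (d - a) * d = b := by
      rw [hc]; field_simp; ring
    have p2 : (b - a) / (d - a) * a + (c - a) / (d - a) * d = c := by
      rw [hc]; field_simp; ring
    simp only [smul_eq_mul] at k1 k2
    rw [p1] at k1
    rw [p2] at k2
    have : g a + g d = ((c - a) / (d - a) + (b - a) / (d - a)) * (g a + g d) := by
      rw [e1, one_mul]
    rw [this]
    linarith

theorem aux_int {mΩ : MeasurableSpace Ω} (P : Measure Ω) [IsProbabilityMeasure P]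
    {u : ℝ → ℝ} (h : Uicx u) {X Z : Ω → ℝ} (hX : BddMeas mΩ X) (hZ : BddMeas mΩ Z) :
    Integrable (fun ω => u (max (X ω - Z ω) 0)) P := by
  have hm : Monotone (fun t : ℝ => u (max t 0)) := fun s t hst =>
    h.1.monotoneOn (Set.mem_Ici.2 (le_max_right _ _)) (Set.mem_Ici.2 (le_max_right _ _))
      (max_le_max_right 0 hst)
  obtain ⟨hXm, C, hC⟩ := hX
  obtain ⟨hZm, D, hD⟩ := hZ
  refine Integrable.of_bound (C := u (max (C + D) 0))
    (hm.measurable.comp (hXm.sub hZm)).aestronglyMeasurable (Eventually.of_forall fun ω => ?_)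
  have h0 : 0 ≤ u (max (X ω - Z ω) 0) := by
    refine h.2.2.1.symm.le.trans ?_
    exact h.1.monotoneOn (Set.mem_Ici.2 le_rfl) (Set.mem_Ici.2 (le_max_right _ _))
      (le_max_right _ _)
  rw [Real.norm_of_nonneg h0]
  apply hm
  have := abs_le.1 (hC ω)
  have := abs_le.1 (hD ω)
  linarith

theorem aux_bdd_min {m : MeasurableSpace Ω} {Z W : Ω → ℝ} (hZ : BddMeas m Z) (hW : BddMeas m W) :
    BddMeas m (fun ω => min (Z ω) (W ω)) := by
  obtain ⟨hXm, C, hC⟩ := hZ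
  obtain ⟨hZm, D, hD⟩ := hW
  refine ⟨hXm.min hZm, max C D, fun ω => ?_⟩
  rcases min_choice (Z ω) (W ω) with e | e <;> simp only [e]
  · exact (hC ω).trans (le_max_left _ _)
  · exact (hD ω).trans (le_max_right _ _)

theorem aux_bdd_max {m : MeasurableSpace Ω} {Z W : Ω → ℝ} (hZ : BddMeas m Z) (hW : BddMeas m W) :
    BddMeas m (fun ω => max (Z ω) (W ω)) := by
  obtain ⟨hXm, C, hC⟩ := hZ
  obtain ⟨hZm, D, hD⟩ := hW
  refine ⟨hXm.max hZm, max C D, fun ω => ?_⟩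
  rcases max_choice (Z ω) (W ω) with e | e <;> simp only [e]
  · exact (hC ω).trans (le_max_left _ _)
  · exact (hD ω).trans (le_max_right _ _)

theorem aux_bdd_mono {m m' : MeasurableSpace Ω} (h : m ≤ m') {Z : Ω → ℝ} (hZ : BddMeas m Z) :
    BddMeas m' Z := ⟨hZ.1.mono h le_rfl, hZ.2⟩

/-- Submodularity of the risk functional. -/
theorem aux_sub {mΩ : MeasurableSpace Ω} (P : Measure Ω) [IsProbabilityMeasure P]
    {u1 u2 : ℝ → ℝ} (h1 : Uicx u1) (h2 : Uicx u2) {α : ℝ} (hα : α ∈ Set.Ioo (0:ℝ) 1)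
    {X Y Z W : Ω → ℝ} (hX : BddMeas mΩ X) (hY : BddMeas mΩ Y) (hXY : X ≤ᵐ[P] Y)
    (hZ : BddMeas mΩ Z) (hW : BddMeas mΩ W) :
    piRisk P u1 u2 α X (fun ω => min (Z ω) (W ω)) + piRisk P u1 u2 α Y (fun ω => max (Z ω) (W ω))
      ≤ piRisk P u1 u2 α X Z + piRisk P u1 u2 α Y W := by
  have hmin := aux_bdd_min hZ hW
  have hmax := aux_bdd_max hZ hW
  have k1 : ∫ ω, u1 (max (X ω - min (Z ω) (W ω)) 0) ∂P + ∫ ω, u1 (max (Y ω - max (Z ω) (W ω)) 0) ∂P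
      ≤ ∫ ω, u1 (max (X ω - Z ω) 0) ∂P + ∫ ω, u1 (max (Y ω - W ω) 0) ∂P := by
    rw [← integral_add (aux_int P h1 hX hmin) (aux_int P h1 hY hmax),
      ← integral_add (aux_int P h1 hX hZ) (aux_int P h1 hY hW)]
    apply integral_mono_ae ((aux_int P h1 hX hmin).add (aux_int P h1 hY hmax))
      ((aux_int P h1 hX hZ).add (aux_int P h1 hY hW))
    filter_upwards [hXY] with ω hω
    rcases le_total (Z ω) (W ω) with h | h
    · simp [min_eq_left h, max_eq_right h]
    · simp only [min_eq_right h, max_eq_left h, Pi.add_apply]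
      exact aux_four (aux_convex h1) (a := X ω - Z ω) (b := X ω - W ω) (c := Y ω - Z ω)
        (d := Y ω - W ω) (by linarith) (by linarith) (by ring)
  have k2 : ∫ ω, u2 (max (min (Z ω) (W ω) - X ω) 0) ∂P + ∫ ω, u2 (max (max (Z ω) (W ω) - Y ω) 0) ∂P
      ≤ ∫ ω, u2 (max (Z ω - X ω) 0) ∂P + ∫ ω, u2 (max (W ω - Y ω) 0) ∂P := by
    rw [← integral_add (aux_int P h2 hmin hX) (aux_int P h2 hmax hY),
      ← integral_add (aux_int P h2 hZ hX) (aux_int P h2 hW hY)]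
    apply integral_mono_ae ((aux_int P h2 hmin hX).add (aux_int P h2 hmax hY))
      ((aux_int P h2 hZ hX).add (aux_int P h2 hW hY))
    filter_upwards [hXY] with ω hω
    rcases le_total (Z ω) (W ω) with h | h
    · simp [min_eq_left h, max_eq_right h]
    · simp only [min_eq_right h, max_eq_left h, Pi.add_apply]
      have := aux_four (aux_convex h2) (a := W ω - Y ω) (b := W ω - X ω) (c := Z ω - Y ω)
        (d := Z ω - X ω) (by linarith) (by linarith) (by ring)
      linarith
  have m1 := mul_le_mul_of_nonneg_left k1 hα.1.le
  have m2 := mul_le_mul_of_nonneg_left k2 (sub_nonneg.2 hα.2.le)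
  unfold piRisk
  linarith

/-- Proposition 5.1 (ii): the conditional generalized quantile is
monotone: `X ≤ Y` a.s. implies `ρ_α^𝒢(X) ≤ ρ_α^𝒢(Y)` a.s. -/
theorem conditional_generalized_quantile_monotone
    [mΩ : MeasurableSpace Ω] (P : Measure Ω) [IsProbabilityMeasure P]
    (hP : Nonatomic P) (𝒢 : MeasurableSpace Ω) (hG : 𝒢 ≤ mΩ)
    {u1 u2 : ℝ → ℝ} (h1 : Uicx u1) (h2 : Uicx u2)
    {α : ℝ} (hα : α ∈ Set.Ioo (0:ℝ) 1)
    (X Y : Ω → ℝ) (hX : BddMeas mΩ X) (hY : BddMeas mΩ Y) (hXY : X ≤ᵐ[P] Y)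
    (ρX ρY : Ω → ℝ)
    (hρX : IsEssInf P (ArgminSet P 𝒢 u1 u2 α X) ρX)
    (hρY : IsEssInf P (ArgminSet P 𝒢 u1 u2 α Y) ρY) :
    ρX ≤ᵐ[P] ρY := by
  have hne : (ArgminSet P 𝒢 u1 u2 α X).Nonempty := by
    by_contra hem
    rw [Set.not_nonempty_iff_eq_empty] at hem
    have := hρX.2 (fun ω => ρX ω + 1) (by simp [hem])
    have hf : ∀ᵐ ω ∂P, False := by
      filter_upwards [this] with ω hω
      linarith
    obtain ⟨_, hh⟩ := hf.exists
    exact hh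
  obtain ⟨Z, hZ, hZmin⟩ := hne
  apply hρY.2
  rintro W ⟨hW, hWmin⟩
  have hs := aux_sub P h1 h2 hα hX hY hXY (aux_bdd_mono hG hZ) (aux_bdd_mono hG hW)
  have hw := hWmin _ (aux_bdd_max hZ hW)
  have hmem : (fun ω => min (Z ω) (W ω)) ∈ ArgminSet P 𝒢 u1 u2 α X := by
    refine ⟨aux_bdd_min hZ hW, fun V hV => ?_⟩
    have := hZmin V hV
    linarith
  filter_upwards [hρX.1 _ hmem] with ω hω
  exact hω.trans (min_le_right _ _)
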